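/- Let w > 2, let Γ_w be the Hecke triangle group with cusp width w, and set Λ₀ := Λ(Γ_w) ∩ {x ∈ ℂ : Im x = 0, -1 < Re x < 1}. Then the Minkowski dimension of Λ₀ exists and equals its Hausdorff dimension; precisely, with Ω(h) := {z ∈ ℂ : dist(z, Λ₀) < h}, the quotient log(vol(Ω(h)))/log(h) tends to 2 − dimH(Λ₀) as h → 0⁺. -/

import Mathlib

open MeasureTheory

/-- `S = [[0,1],[-1,0]]` as an element of `SL(2,ℝ)`. -/
noncomputable def S : Matrix.SpecialLinearGroup (Fin 2) ℝ :=
  ⟨!![0, 1; -1, 0], by norm_num [Matrix.det_fin_two_of]⟩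

/-- `T_w = [[1,w],[0,1]]` as an element of `SL(2,ℝ)`. -/
noncomputable def T (w : ℝ) : Matrix.SpecialLinearGroup (Fin 2) ℝ :=
  ⟨!![1, w; 0, 1], by norm_num [Matrix.det_fin_two_of]⟩

/-- The Hecke triangle group `Γ_w`, the subgroup of `SL(2,ℝ)` generated by `S` and `T_w`. -/
noncomputable def heckeGroup (w : ℝ) : Subgroup (Matrix.SpecialLinearGroup (Fin 2) ℝ) :=
  Subgroup.closure {S, T w}

/-- The Möbius action of an element of `SL(2,ℝ)` on `ℂ`. -/
noncomputable def moebius (γ : Matrix.SpecialLinearGroup (Fin 2) ℝ) (z : ℂ) : ℂ :=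
  (((γ : Matrix (Fin 2) (Fin 2) ℝ) 0 0 : ℝ) * z + ((γ : Matrix (Fin 2) (Fin 2) ℝ) 0 1 : ℝ)) /
    (((γ : Matrix (Fin 2) (Fin 2) ℝ) 1 0 : ℝ) * z + ((γ : Matrix (Fin 2) (Fin 2) ℝ) 1 1 : ℝ))

/-- The limit set of a subgroup `Γ` of `SL(2,ℝ)`: the set of accumulation points in `ℂ`
of the orbit of `i ∈ ℍ` under `Γ`. -/
noncomputable def limitSet (Γ : Subgroup (Matrix.SpecialLinearGroup (Fin 2) ℝ)) : Set ℂ :=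
  {x : ℂ | AccPt x (Filter.principal ((fun γ => moebius γ Complex.I) ''
    (Γ : Set (Matrix.SpecialLinearGroup (Fin 2) ℝ))))}

/-! ### A lower bound for the Hausdorff dimension -/

lemma rpow_le_sum_diam_rpow {X ι : Type*} [PseudoMetricSpace X] {A : Finset ι} (hA : 1 < A.card)
    {f : ι → X → X} {c : ι → ℝ} (hc : ∀ i ∈ A, 0 < c i) {F : Set X} (hb : Bornology.IsBounded F)
    (hne : F.Nonempty) (hmaps : ∀ i ∈ A, Set.MapsTo (f i) F F)
    (hlow : ∀ i ∈ A, ∀ x ∈ F, ∀ y ∈ F, c i * dist x y ≤ dist (f i x) (f i y))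
    {g : ℝ} (hg : 0 < g)
    (hgap : ∀ i ∈ A, ∀ j ∈ A, i ≠ j → ∀ x ∈ F, ∀ y ∈ F, g ≤ dist (f i x) (f j y))
    {t : ℝ} (ht : 0 < t) (hsum : 1 ≤ ∑ i ∈ A, c i ^ t) (s : Finset ℕ) (U : ℕ → Set X)
    (hcov : F ⊆ ⋃ j ∈ s, U j) :
    g ^ t ≤ ∑ j ∈ s, Metric.diam (F ∩ U j) ^ t := by
  classical
  induction s using Finset.strongInduction generalizing U with
  | H s ih =>
  by_contra! hlt
  let J : ι → Finset ℕ := fun i => s.filter fun j => ∃ x ∈ F, f i x ∈ U j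
  have hbU : ∀ j, Bornology.IsBounded (F ∩ U j) := fun j => hb.subset Set.inter_subset_left
  have hdg : ∀ j ∈ s, Metric.diam (F ∩ U j) < g := by
    intro j hj
    have h1 : Metric.diam (F ∩ U j) ^ t < g ^ t :=
      (Finset.single_le_sum (f := fun j => Metric.diam (F ∩ U j) ^ t)
        (fun k _ => Real.rpow_nonneg Metric.diam_nonneg t) hj).trans_lt hlt
    exact (Real.rpow_lt_rpow_iff Metric.diam_nonneg hg.le ht).1 h1
  have hdisj : ∀ i ∈ A, ∀ i' ∈ A, i ≠ i' → Disjoint (J i) (J i') := by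
    intro i hi i' hi' hne'
    rw [Finset.disjoint_left]
    intro j hj hj'
    obtain ⟨hjs, x, hx, hxU⟩ := Finset.mem_filter.1 hj
    obtain ⟨-, y, hy, hyU⟩ := Finset.mem_filter.1 hj'
    have h1 := Metric.dist_le_diam_of_mem (hbU j) ⟨hmaps i hi hx, hxU⟩ ⟨hmaps i' hi' hy, hyU⟩
    linarith [hdg j hjs, hgap i hi i' hi' hne' x hx y hy]
  have hJcov : ∀ i ∈ A, F ⊆ ⋃ j ∈ J i, f i ⁻¹' U j := by
    intro i hi x hx
    obtain ⟨j, hj, hxj⟩ := Set.mem_iUnion₂.1 (hcov (hmaps i hi hx))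
    exact Set.mem_iUnion₂.2 ⟨j, Finset.mem_filter.2 ⟨hj, x, hx, hxj⟩, hxj⟩
  have hJne : ∀ i ∈ A, (J i).Nonempty := by
    intro i hi
    obtain ⟨x, hx⟩ := hne
    obtain ⟨j, hj, -⟩ := Set.mem_iUnion₂.1 (hJcov i hi hx)
    exact ⟨j, hj⟩
  have hJs : ∀ i ∈ A, J i ⊂ s := by
    intro i hi
    refine ⟨Finset.filter_subset _ _, fun hsub => ?_⟩
    obtain ⟨i', hi', hne'⟩ := Finset.exists_mem_ne hA i
    obtain ⟨j, hj⟩ := hJne i' hi'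
    exact Finset.disjoint_left.1 (hdisj i' hi' i hi hne') hj
      (hsub (Finset.filter_subset _ _ hj))
  have hstep : ∀ i ∈ A, c i ^ t * g ^ t ≤ ∑ j ∈ J i, Metric.diam (F ∩ U j) ^ t := by
    intro i hi
    refine (mul_le_mul_of_nonneg_left (ih _ (hJs i hi) _ (hJcov i hi))
      (Real.rpow_nonneg (hc i hi).le t)).trans ?_
    rw [Finset.mul_sum]
    refine Finset.sum_le_sum fun j _ => ?_
    rw [← Real.mul_rpow (hc i hi).le Metric.diam_nonneg]
    refine Real.rpow_le_rpow (mul_nonneg (hc i hi).le Metric.diam_nonneg) ?_ ht.le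
    rw [mul_comm, ← le_div_iff₀ (hc i hi)]
    refine Metric.diam_le_of_forall_dist_le (div_nonneg Metric.diam_nonneg (hc i hi).le) ?_
    intro x hx y hy
    rw [le_div_iff₀ (hc i hi), mul_comm]
    exact (hlow i hi x hx.1 y hy.1).trans
      (Metric.dist_le_diam_of_mem (hbU j) ⟨hmaps i hi hx.1, hx.2⟩ ⟨hmaps i hi hy.1, hy.2⟩)
  have h1 : g ^ t ≤ ∑ i ∈ A, ∑ j ∈ J i, Metric.diam (F ∩ U j) ^ t := by
    refine le_trans ?_ (Finset.sum_le_sum hstep)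
    rw [← Finset.sum_mul]
    exact le_mul_of_one_le_left (Real.rpow_nonneg hg.le t) hsum
  rw [← Finset.sum_biUnion hdisj] at h1
  have h2 : ∑ j ∈ A.biUnion J, Metric.diam (F ∩ U j) ^ t ≤ ∑ j ∈ s, Metric.diam (F ∩ U j) ^ t :=
    Finset.sum_le_sum_of_subset_of_nonneg
      (Finset.biUnion_subset.2 fun i _ => Finset.filter_subset _ _)
      (fun k _ _ => Real.rpow_nonneg Metric.diam_nonneg t)
  linarith

open scoped ENNReal NNReal in
lemma exists_open_superset_ediam_rpow_le {X : Type*} [PseudoMetricSpace X] (s : Set X) {t : ℝ}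
    (ht : 0 < t) (hs : Metric.ediam s ≠ ∞) {ε : ℝ≥0∞} (hε : ε ≠ 0) :
    ∃ V, IsOpen V ∧ s ⊆ V ∧
      Metric.ediam V ^ t ≤ (⨆ _ : s.Nonempty, Metric.ediam s ^ t) + ε := by
  rcases s.eq_empty_or_nonempty with rfl | hne
  · exact ⟨∅, isOpen_empty, subset_rfl, by simp [ENNReal.zero_rpow_of_pos ht]⟩
  have hcont : Continuous fun η : ℝ≥0 => (Metric.ediam s + 2 * (η : ℝ≥0∞)) ^ t :=
    ENNReal.continuous_rpow_const.comp (continuous_const.add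
      (ENNReal.continuous_const_mul (by simp) |>.comp ENNReal.continuous_coe))
  have hlt : (fun η : ℝ≥0 => (Metric.ediam s + 2 * (η : ℝ≥0∞)) ^ t) 0 <
      Metric.ediam s ^ t + ε := by
    simpa using ENNReal.lt_add_right (ENNReal.rpow_ne_top_of_nonneg ht.le hs) hε
  have hev := (hcont.tendsto 0).eventually_lt_const hlt
  obtain ⟨η, h1, h2⟩ :=
    ((hev.filter_mono nhdsWithin_le_nhds).and (self_mem_nhdsWithin (s := Set.Ioi (0 : ℝ≥0)))).exists
  refine ⟨Metric.thickening η s, Metric.isOpen_thickening, Metric.self_subset_thickening h2 s, ?_⟩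
  simp only [hne, ciSup_unique]
  exact (ENNReal.rpow_le_rpow (Metric.ediam_thickening_le η) ht.le).trans h1.le

lemma exists_pos_gap {X ι : Type*} [MetricSpace X] {A : Finset ι}
    {f : ι → X → X} {F : Set X} (hF : IsCompact F) (hne : F.Nonempty)
    (hcont : ∀ i ∈ A, ContinuousOn (f i) F)
    (hinj : ∀ i ∈ A, ∀ j ∈ A, ∀ x ∈ F, ∀ y ∈ F, f i x = f j y → i = j) :
    ∃ g : ℝ, 0 < g ∧ ∀ i ∈ A, ∀ j ∈ A, i ≠ j → ∀ x ∈ F, ∀ y ∈ F, g ≤ dist (f i x) (f j y) := by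
  have hev : ∀ᶠ g in nhdsWithin (0 : ℝ) (Set.Ioi 0),
      ∀ i ∈ A, ∀ j ∈ A, i ≠ j → ∀ x ∈ F, ∀ y ∈ F, g ≤ dist (f i x) (f j y) := by
    rw [Filter.eventually_all_finset]
    intro i hi
    rw [Filter.eventually_all_finset]
    intro j hj
    rw [Filter.eventually_imp_distrib_left]
    intro hij
    have hci : ContinuousOn (fun p : X × X => f i p.1) (F ×ˢ F) :=
      (hcont i hi).comp continuousOn_fst fun p hp => hp.1
    have hcj : ContinuousOn (fun p : X × X => f j p.2) (F ×ˢ F) :=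
      (hcont j hj).comp continuousOn_snd fun p hp => hp.2
    have hc := continuous_dist.comp_continuousOn (hci.prodMk hcj)
    obtain ⟨p, hp, hmin⟩ := (hF.prod hF).exists_isMinOn (hne.prod hne) hc
    have hpos : 0 < dist (f i p.1) (f j p.2) :=
      dist_pos.2 fun h => hij (hinj i hi j hj _ hp.1 _ hp.2 h)
    filter_upwards [Ioo_mem_nhdsGT hpos] with g hg x hx y hy
    exact hg.2.le.trans (hmin (Set.mk_mem_prod hx hy))
  obtain ⟨g, h1, h2⟩ := (hev.and self_mem_nhdsWithin).exists
  exact ⟨g, h2, h1⟩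

open scoped ENNReal NNReal in
lemma le_dimH_of_one_le_sum_rpow {X ι : Type*} [MetricSpace X] {A : Finset ι} (hA : 1 < A.card)
    {f : ι → X → X} {c : ι → ℝ} (hc : ∀ i ∈ A, 0 < c i) {F : Set X} (hF : IsCompact F)
    (hne : F.Nonempty) (hcont : ∀ i ∈ A, ContinuousOn (f i) F)
    (hmaps : ∀ i ∈ A, Set.MapsTo (f i) F F)
    (hinj : ∀ i ∈ A, ∀ j ∈ A, ∀ x ∈ F, ∀ y ∈ F, f i x = f j y → i = j)
    (hlow : ∀ i ∈ A, ∀ x ∈ F, ∀ y ∈ F, c i * dist x y ≤ dist (f i x) (f i y))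
    {t : ℝ≥0} (ht : 0 < t) (hsum : 1 ≤ ∑ i ∈ A, c i ^ (t : ℝ)) : t ≤ dimH F := by
  borelize X
  refine le_dimH_of_hausdorffMeasure_ne_zero fun h0 => ?_
  have ht' : (0 : ℝ) < t := ht
  obtain ⟨g, hg, hgap⟩ := exists_pos_gap hF hne hcont hinj
  have hgt : 0 < g ^ (t : ℝ) := Real.rpow_pos_of_pos hg _
  have hε : ENNReal.ofReal (g ^ (t : ℝ)) / 2 ≠ 0 := by
    simp [hgt]
  rw [Measure.hausdorffMeasure_apply] at h0
  have h1 : (⨅ (U : ℕ → Set X) (_ : F ⊆ ⋃ n, U n) (_ : ∀ n, Metric.ediam (U n) ≤ 1),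
      ∑' n, ⨆ _ : (U n).Nonempty, Metric.ediam (U n) ^ (t : ℝ)) <
        ENNReal.ofReal (g ^ (t : ℝ)) / 2 := by
    refine lt_of_le_of_lt ?_ (pos_iff_ne_zero.2 hε)
    rw [← h0]
    exact le_iSup₂ (f := fun (r : ℝ≥0∞) (_ : 0 < r) =>
      ⨅ (U : ℕ → Set X) (_ : F ⊆ ⋃ n, U n) (_ : ∀ n, Metric.ediam (U n) ≤ r),
        ∑' n, ⨆ _ : (U n).Nonempty, Metric.ediam (U n) ^ (t : ℝ)) 1 one_pos
  simp only [iInf_lt_iff] at h1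
  obtain ⟨U, hcov, hdiam, hlt⟩ := h1
  obtain ⟨ε, hεpos, hεsum⟩ := ENNReal.exists_pos_sum_of_countable' hε ℕ
  choose V hVo hUV hV using fun n => exists_open_superset_ediam_rpow_le (U n) ht'
    (ne_top_of_le_ne_top ENNReal.one_ne_top (hdiam n)) (hεpos n).ne'
  obtain ⟨s, hs⟩ := hF.elim_finite_subcover V hVo (hcov.trans (Set.iUnion_mono hUV))
  have key := rpow_le_sum_diam_rpow hA hc hF.isBounded hne hmaps hlow hg hgap ht' hsum s V hs
  have h2 : ENNReal.ofReal (∑ j ∈ s, Metric.diam (F ∩ V j) ^ (t : ℝ)) ≤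
      ∑ j ∈ s, Metric.ediam (V j) ^ (t : ℝ) := by
    rw [ENNReal.ofReal_sum_of_nonneg fun j _ => Real.rpow_nonneg Metric.diam_nonneg _]
    refine Finset.sum_le_sum fun j _ => ?_
    rw [← ENNReal.ofReal_rpow_of_nonneg Metric.diam_nonneg ht'.le]
    refine ENNReal.rpow_le_rpow ?_ ht'.le
    exact ENNReal.ofReal_toReal_le.trans (Metric.ediam_mono Set.inter_subset_right)
  have h3 : ∑ j ∈ s, Metric.ediam (V j) ^ (t : ℝ) < ENNReal.ofReal (g ^ (t : ℝ)) := by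
    calc _ ≤ ∑' j, Metric.ediam (V j) ^ (t : ℝ) := ENNReal.sum_le_tsum _
      _ ≤ ∑' j, ((⨆ _ : (U j).Nonempty, Metric.ediam (U j) ^ (t : ℝ)) + ε j) :=
        ENNReal.tsum_le_tsum hV
      _ = _ := ENNReal.tsum_add
      _ < ENNReal.ofReal (g ^ (t : ℝ)) / 2 + ENNReal.ofReal (g ^ (t : ℝ)) / 2 :=
        ENNReal.add_lt_add hlt hεsum
      _ = _ := ENNReal.add_halves _
  exact absurd (((ENNReal.ofReal_le_ofReal key).trans h2).trans_lt h3) (lt_irrefl _)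

/-! ### A lower bound for the volume of neighbourhoods -/

open scoped ENNReal NNReal in
lemma exists_separated_net {X : Type*} [PseudoMetricSpace X] {F : Set X} (hF : IsCompact F)
    {h : ℝ} (hh : 0 < h) :
    ∃ C : Finset X, ↑C ⊆ F ∧ (C : Set X).Pairwise (fun x y => h ≤ dist x y) ∧
      F ⊆ ⋃ x ∈ C, Metric.closedBall x h := by
  lift h to ℝ≥0 using hh.le
  have hpack : Metric.packingNumber h F ≠ ⊤ := by
    obtain ⟨N, hN, hfin, hcover⟩ :=
      Metric.exists_finite_isCover_of_isCompact (ε := h / 2)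
        (div_ne_zero (by exact_mod_cast hh.ne') two_ne_zero) hF
    have h1 := (Metric.packingNumber_two_mul_le_externalCoveringNumber (h / 2) F).trans
      hcover.externalCoveringNumber_le_encard
    rw [mul_div_cancel₀ h two_ne_zero] at h1
    exact ne_top_of_le_ne_top (Set.encard_ne_top_iff.2 hfin) h1
  have hfin : (Metric.maximalSeparatedSet h F).Finite := by
    rw [← Set.encard_ne_top_iff, Metric.encard_maximalSeparatedSet hpack]
    exact hpack
  refine ⟨hfin.toFinset, ?_, ?_, ?_⟩
  · simpa using Metric.maximalSeparatedSet_subset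
  · rw [hfin.coe_toFinset]
    intro x hx y hy hxy
    have : (h : ℝ≥0∞) < edist x y := Metric.isSeparated_maximalSeparatedSet hx hy hxy
    rw [edist_nndist, ENNReal.coe_lt_coe] at this
    exact_mod_cast this.le
  · simpa using (Metric.isCover_maximalSeparatedSet hpack).subset_iUnion_closedBall

lemma card_mul_le_volume_thickening {F : Set ℂ} (hF : IsCompact F) {h : ℝ} (hh : 0 < h)
    {C : Finset ℂ} (hC : ↑C ⊆ F) (hsep : (C : Set ℂ).Pairwise (fun x y => h ≤ dist x y)) :
    C.card * (Real.pi * (h / 2) ^ 2) ≤ (volume (Metric.thickening h F)).toReal := by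
  have hfin : volume (Metric.thickening h F) ≠ ⊤ := hF.isBounded.thickening.measure_lt_top.ne
  have hdisj : (C : Set ℂ).PairwiseDisjoint fun x => Metric.ball x (h / 2) := by
    intro x hx y hy hxy
    exact Metric.ball_disjoint_ball (by linarith [hsep hx hy hxy])
  have hsub : (⋃ x ∈ C, Metric.ball x (h / 2)) ⊆ Metric.thickening h F := by
    refine Set.iUnion₂_subset fun x hx => ?_
    exact (Metric.ball_subset_ball (by linarith)).trans (Metric.ball_subset_thickening (hC hx) h)
  have h1 := measure_mono (μ := volume) hsub
  rw [measure_biUnion_finset hdisj fun _ _ => Metric.isOpen_ball.measurableSet] at h1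
  simp only [Complex.volume_ball, Finset.sum_const, nsmul_eq_mul] at h1
  have h2 := ENNReal.toReal_mono hfin h1
  simpa [ENNReal.toReal_ofReal (by positivity : 0 ≤ h / 2), mul_comm] using h2

lemma ediam_closedBall_le_ofReal {X : Type*} [PseudoMetricSpace X] (x : X) (h : ℝ) :
    Metric.ediam (Metric.closedBall x h) ≤ ENNReal.ofReal (2 * h) := by
  refine Metric.ediam_le fun y hy z hz => ?_
  rw [edist_dist]
  refine ENNReal.ofReal_le_ofReal ?_
  linarith [dist_triangle_right y z x, Metric.mem_closedBall.1 hy, Metric.mem_closedBall.1 hz]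

open scoped ENNReal NNReal in
lemma eventually_rpow_le_volume_thickening {F : Set ℂ} (hF : IsCompact F) {d : ℝ≥0}
    (hd : d < dimH F) :
    ∀ᶠ h in nhdsWithin (0 : ℝ) (Set.Ioi 0),
      h ^ (2 - (d : ℝ)) ≤ (volume (Metric.thickening h F)).toReal := by
  classical
  choose! C hCF hCsep hCcov using fun (h : ℝ) (hh : 0 < h) => exists_separated_net hF hh
  have hle := Measure.hausdorffMeasure_le_liminf_sum (ι := fun h : ℝ => C h) (d : ℝ) F
    (l := nhdsWithin (0 : ℝ) (Set.Ioi 0)) (fun h => ENNReal.ofReal (2 * h)) (by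
      have : Filter.Tendsto (fun h : ℝ => ENNReal.ofReal (2 * h)) (nhds 0)
          (nhds (ENNReal.ofReal (2 * 0))) :=
        (ENNReal.continuous_ofReal.comp (continuous_const.mul continuous_id)).tendsto 0
      rw [mul_zero, ENNReal.ofReal_zero] at this
      exact this.mono_left nhdsWithin_le_nhds)
    (fun h x => Metric.closedBall x.1 h)
    (by
      filter_upwards [self_mem_nhdsWithin] with h hh x
      exact ediam_closedBall_le_ofReal x.1 h)
    (by
      filter_upwards [self_mem_nhdsWithin] with h hh
      simpa [Set.iUnion_subtype] using hCcov h hh)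
  rw [hausdorffMeasure_of_lt_dimH hd, top_le_iff] at hle
  set M : ℝ := 2 ^ (d : ℝ) * 4 with hM
  have hev := Filter.eventually_lt_of_lt_liminf (hle ▸ (ENNReal.ofReal_lt_top (r := M)))
  filter_upwards [hev, self_mem_nhdsWithin] with h h1 hh
  have h0 : (0 : ℝ) < h := hh
  have h2 : ENNReal.ofReal M ≤ ENNReal.ofReal ((C h).card * (2 * h) ^ (d : ℝ)) := by
    refine h1.le.trans ?_
    rw [ENNReal.ofReal_mul (by positivity), ENNReal.ofReal_natCast,
      ← ENNReal.ofReal_rpow_of_nonneg (mul_pos two_pos h0).le d.coe_nonneg]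
    refine (Finset.sum_le_card_nsmul _ _ (ENNReal.ofReal (2 * h) ^ (d : ℝ)) fun x _ => ?_).trans ?_
    · refine ENNReal.rpow_le_rpow ?_ d.coe_nonneg
      exact ediam_closedBall_le_ofReal x.1 h
    · simp
  rw [ENNReal.ofReal_le_ofReal_iff (by positivity), Real.mul_rpow (by norm_num) h0.le, hM] at h2
  have h3 : 4 ≤ (C h).card * h ^ (d : ℝ) := by
    have : (0 : ℝ) < 2 ^ (d : ℝ) := by positivity
    nlinarith
  refine le_trans ?_ (card_mul_le_volume_thickening hF h0 (hCF h h0) (hCsep h h0))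
  rw [Real.rpow_sub h0, Real.rpow_two, div_le_iff₀ (by positivity)]
  have h4 := Real.pi_gt_three
  have h5 : (C h).card * (Real.pi * (h / 2) ^ 2) * h ^ (d : ℝ) =
      Real.pi / 4 * h ^ 2 * ((C h).card * h ^ (d : ℝ)) := by ring
  rw [h5]
  nlinarith [sq_nonneg h, mul_le_mul_of_nonneg_left h3 (by positivity : 0 ≤ Real.pi / 4 * h ^ 2)]

/-! ### Möbius transformations -/

lemma moebius_mul (A B : Matrix.SpecialLinearGroup (Fin 2) ℝ) (z : ℂ)
    (h : ((B 1 0 : ℝ) : ℂ) * z + (B 1 1 : ℝ) ≠ 0) :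
    moebius (A * B) z = moebius A (moebius B z) := by
  simp only [moebius, Matrix.SpecialLinearGroup.coe_mul, Matrix.mul_apply, Fin.sum_univ_two]
  push_cast
  have h1 : ∀ a b : ℂ, a * (((B 0 0 : ℝ) * z + (B 0 1 : ℝ)) / ((B 1 0 : ℝ) * z + (B 1 1 : ℝ))) + b
      = (a * ((B 0 0 : ℝ) * z + (B 0 1 : ℝ)) + b * ((B 1 0 : ℝ) * z + (B 1 1 : ℝ)))
        / ((B 1 0 : ℝ) * z + (B 1 1 : ℝ)) := by
    intro a b
    rw [← mul_div_assoc, div_add' _ _ _ h]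
  rw [h1, h1, div_div_div_cancel_right₀ h]
  congr 1 <;> ring

lemma moebius_sub (A : Matrix.SpecialLinearGroup (Fin 2) ℝ) (z y : ℂ)
    (hz : ((A 1 0 : ℝ) : ℂ) * z + (A 1 1 : ℝ) ≠ 0)
    (hy : ((A 1 0 : ℝ) : ℂ) * y + (A 1 1 : ℝ) ≠ 0) :
    moebius A z - moebius A y =
      (z - y) / (((A 1 0 : ℝ) * z + (A 1 1 : ℝ)) * ((A 1 0 : ℝ) * y + (A 1 1 : ℝ))) := by
  have hdet : ((A 0 0 : ℝ) : ℂ) * (A 1 1 : ℝ) - (A 0 1 : ℝ) * (A 1 0 : ℝ) = 1 := by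
    have := A.det_coe
    rw [Matrix.det_fin_two] at this
    exact_mod_cast this
  simp only [moebius]
  rw [div_sub_div _ _ hz hy]
  congr 1
  linear_combination (z - y) * hdet

lemma denom_ne_zero_of_im (A : Matrix.SpecialLinearGroup (Fin 2) ℝ) {z : ℂ} (hz : z.im ≠ 0) :
    ((A 1 0 : ℝ) : ℂ) * z + (A 1 1 : ℝ) ≠ 0 := by
  intro h
  have him := congrArg Complex.im h
  have hre := congrArg Complex.re h
  simp [hz] at him
  simp [him] at hre
  have := A.det_coe
  rw [Matrix.det_fin_two, him, hre] at this
  simp at this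

lemma moebius_S (z : ℂ) : moebius S z = -1 / z := by
  simp [moebius, S, div_neg, neg_div]

lemma moebius_T (w : ℝ) (z : ℂ) : moebius (T w) z = z + w := by
  simp [moebius, T]

lemma S_val : (S : Matrix (Fin 2) (Fin 2) ℝ) = !![0, 1; -1, 0] := rfl

lemma T_val (a : ℝ) : (T a : Matrix (Fin 2) (Fin 2) ℝ) = !![1, a; 0, 1] := rfl

lemma T_add (a b : ℝ) : T (a + b) = T a * T b := by
  ext i j
  rw [Matrix.SpecialLinearGroup.coe_mul, T_val, T_val, T_val]
  fin_cases i <;> fin_cases j <;> simp [add_comm]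

lemma T_zero : T 0 = 1 := by
  ext i j
  fin_cases i <;> fin_cases j <;> simp [T]

lemma T_neg (a : ℝ) : T (-a) = (T a)⁻¹ := by
  rw [eq_inv_iff_mul_eq_one, ← T_add, neg_add_cancel, T_zero]

lemma T_mem_heckeGroup (w : ℝ) (n : ℤ) : T (n * w) ∈ heckeGroup w := by
  have hT : T w ∈ heckeGroup w := Subgroup.subset_closure (by simp)
  induction n using Int.induction_on with
  | zero => simp [T_zero, one_mem]
  | succ k ih =>
    have : T ((((k : ℤ) + 1 : ℤ) : ℝ) * w) = T (((k : ℤ) : ℝ) * w) * T w := by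
      rw [← T_add]; push_cast; ring_nf
    rw [this]
    exact mul_mem ih hT
  | pred k ih =>
    have : T (((-(k : ℤ) - 1 : ℤ) : ℝ) * w) = T (((-(k : ℤ) : ℤ) : ℝ) * w) * (T w)⁻¹ := by
      rw [← T_neg, ← T_add]; push_cast; ring_nf
    rw [this]
    exact mul_mem ih (inv_mem hT)

/-! ### Words in the inverse branches `z ↦ -1 / (z + n w)` -/

/-- Nonzero integers, labelling the branches `z ↦ -1 / (z + n w)`. -/
abbrev Letter := {n : ℤ // n ≠ 0}

/-- The matrix of the branch `z ↦ -1 / (z + n w)`. -/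
noncomputable def letterMatrix (w : ℝ) (n : Letter) : Matrix.SpecialLinearGroup (Fin 2) ℝ :=
  S * T (n.1 * w)

/-- The product of the branch matrices along a word. -/
noncomputable def wordMatrix (w : ℝ) (ω : List Letter) : Matrix.SpecialLinearGroup (Fin 2) ℝ :=
  (ω.map (letterMatrix w)).prod

/-- The composition of the branches along a word. -/
noncomputable def wordMap (w : ℝ) (ω : List Letter) (z : ℂ) : ℂ :=
  moebius (wordMatrix w ω) z

/-- The absolute value of the lower right entry of the matrix of a word. -/
noncomputable def wordDenom (w : ℝ) (ω : List Letter) : ℝ :=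
  |(wordMatrix w ω) 1 1|

lemma Letter.one_le_abs (n : Letter) : (1 : ℝ) ≤ |(n.1 : ℝ)| := by
  exact_mod_cast Int.one_le_abs n.2

lemma letterMatrix_val (w : ℝ) (n : Letter) :
    (letterMatrix w n).1 = !![0, 1; -1, -(n.1 * w)] := by
  rw [letterMatrix, Matrix.SpecialLinearGroup.coe_mul, S_val, T_val]
  simp

lemma wordMatrix_mem_heckeGroup (w : ℝ) (ω : List Letter) : wordMatrix w ω ∈ heckeGroup w := by
  apply Subgroup.list_prod_mem
  intro x hx
  obtain ⟨n, -, rfl⟩ := List.mem_map.1 hx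
  exact mul_mem (Subgroup.subset_closure (by simp)) (T_mem_heckeGroup w n.1)

lemma wordMatrix_append (w : ℝ) (ω τ : List Letter) :
    wordMatrix w (ω ++ τ) = wordMatrix w ω * wordMatrix w τ := by
  simp [wordMatrix]

lemma wordMatrix_concat_one_zero (w : ℝ) (ω : List Letter) (n : Letter) :
    (wordMatrix w (ω ++ [n])) 1 0 = -(wordMatrix w ω) 1 1 := by
  have : wordMatrix w [n] = letterMatrix w n := by simp [wordMatrix]
  rw [wordMatrix_append, this]
  simp [Matrix.SpecialLinearGroup.coe_mul, Matrix.mul_apply, Fin.sum_univ_two, letterMatrix_val]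

lemma wordMatrix_concat_one_one (w : ℝ) (ω : List Letter) (n : Letter) :
    (wordMatrix w (ω ++ [n])) 1 1 = (wordMatrix w ω) 1 0 - (wordMatrix w ω) 1 1 * (n.1 * w) := by
  have : wordMatrix w [n] = letterMatrix w n := by simp [wordMatrix]
  rw [wordMatrix_append, this]
  simp [Matrix.SpecialLinearGroup.coe_mul, Matrix.mul_apply, Fin.sum_univ_two, letterMatrix_val]
  ring

section
variable {w : ℝ}

lemma wordMatrix_bounds (hw : 2 < w) (ω : List Letter) :
    (w - 1) * |(wordMatrix w ω) 1 0| ≤ wordDenom w ω ∧ (w - 1) ^ ω.length ≤ wordDenom w ω := by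
  induction ω using List.reverseRecOn with
  | nil => simp [wordMatrix, wordDenom]
  | append_singleton ω n ih =>
    obtain ⟨h1, h2⟩ := ih
    have hn := n.one_le_abs
    rw [wordDenom] at *
    rw [wordMatrix_concat_one_zero, wordMatrix_concat_one_one, abs_neg]
    set c := (wordMatrix w ω) 1 0
    set d := (wordMatrix w ω) 1 1
    have h3 : |d * (n.1 * w)| - |c| ≤ |c - d * (n.1 * w)| := by
      rw [abs_sub_comm]; exact abs_sub_abs_le_abs_sub _ _
    have h4 : |d| * w ≤ |d * (n.1 * w)| := by
      rw [abs_mul, abs_mul, abs_of_pos (by linarith : (0 : ℝ) < w)]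
      gcongr
      nlinarith
    have hcd : |c| ≤ |d| := by nlinarith [abs_nonneg c]
    have h5 : (w - 1) * |d| ≤ |c - d * (n.1 * w)| := by linarith
    refine ⟨h5, ?_⟩
    rw [List.length_append, List.length_singleton, pow_succ']
    refine le_trans ?_ h5
    gcongr
    linarith

lemma one_le_wordDenom (hw : 2 < w) (ω : List Letter) : 1 ≤ wordDenom w ω :=
  (one_le_pow₀ (by linarith)).trans (wordMatrix_bounds hw ω).2

lemma abs_wordMatrix_one_zero_le (hw : 2 < w) (ω : List Letter) :
    |(wordMatrix w ω) 1 0| ≤ wordDenom w ω := by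
  nlinarith [(wordMatrix_bounds hw ω).1, abs_nonneg ((wordMatrix w ω) 1 0)]

lemma wordDenom_concat_le (hw : 2 < w) (ω : List Letter) (n : Letter) :
    wordDenom w (ω ++ [n]) ≤ (|(n.1 : ℝ)| * w + 1) * wordDenom w ω := by
  have h := abs_wordMatrix_one_zero_le hw ω
  rw [wordDenom] at h
  rw [wordDenom, wordDenom, wordMatrix_concat_one_one]
  refine (abs_sub _ _).trans ?_
  rw [abs_mul, abs_mul, abs_of_pos (by linarith : (0 : ℝ) < w)]
  linarith

lemma wordDenom_singleton (hw : 2 < w) (n : Letter) : wordDenom w [n] = |(n.1 : ℝ)| * w := by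
  simp [wordDenom, wordMatrix, letterMatrix_val, abs_mul, abs_of_pos (by linarith : (0 : ℝ) < w)]

lemma norm_denom_le (hw : 2 < w) (ω : List Letter) {z : ℂ} (hz : ‖z‖ ≤ 1) :
    ‖((wordMatrix w ω 1 0 : ℝ) : ℂ) * z + (wordMatrix w ω 1 1 : ℝ)‖ ≤ 2 * wordDenom w ω := by
  refine (norm_add_le _ _).trans ?_
  rw [norm_mul, Complex.norm_real, Complex.norm_real, Real.norm_eq_abs, Real.norm_eq_abs]
  have h := abs_wordMatrix_one_zero_le hw ω
  rw [wordDenom] at *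
  nlinarith [abs_nonneg ((wordMatrix w ω) 1 0)]

lemma le_norm_denom (hw : 2 < w) (ω : List Letter) {z : ℂ} (hz : ‖z‖ ≤ 1) :
    (w - 2) / (w - 1) * wordDenom w ω ≤
      ‖((wordMatrix w ω 1 0 : ℝ) : ℂ) * z + (wordMatrix w ω 1 1 : ℝ)‖ := by
  have h0 : ‖((wordMatrix w ω 1 1 : ℝ) : ℂ)‖ - ‖((wordMatrix w ω 1 0 : ℝ) : ℂ) * z‖ ≤
      ‖((wordMatrix w ω 1 0 : ℝ) : ℂ) * z + (wordMatrix w ω 1 1 : ℝ)‖ := by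
    rw [add_comm]
    simpa using norm_sub_norm_le ((wordMatrix w ω 1 1 : ℝ) : ℂ) (-(((wordMatrix w ω 1 0 : ℝ) : ℂ) * z))
  refine le_trans ?_ h0
  rw [norm_mul, Complex.norm_real, Complex.norm_real, Real.norm_eq_abs, Real.norm_eq_abs]
  have h := (wordMatrix_bounds hw ω).1
  rw [wordDenom] at *
  have hw1 : 0 < w - 1 := by linarith
  rw [div_mul_eq_mul_div, div_le_iff₀ hw1]
  have := mul_le_of_le_one_right (abs_nonneg ((wordMatrix w ω) 1 0)) hz
  nlinarith

lemma denom_ne_zero (hw : 2 < w) (ω : List Letter) {z : ℂ} (hz : ‖z‖ ≤ 1) :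
    ((wordMatrix w ω 1 0 : ℝ) : ℂ) * z + (wordMatrix w ω 1 1 : ℝ) ≠ 0 := by
  rw [← norm_pos_iff]
  refine lt_of_lt_of_le ?_ (le_norm_denom hw ω hz)
  have := one_le_wordDenom hw ω
  have h1 : 0 < w - 1 := by linarith
  have h2 : 0 < w - 2 := by linarith
  positivity

lemma wordMap_nil (z : ℂ) : wordMap w [] z = z := by
  simp [wordMap, wordMatrix, moebius]

lemma wordMap_append (hw : 2 < w) (ω τ : List Letter) {z : ℂ} (hz : ‖z‖ ≤ 1) :
    wordMap w (ω ++ τ) z = wordMap w ω (wordMap w τ z) := by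
  rw [wordMap, wordMatrix_append, moebius_mul _ _ _ (denom_ne_zero hw τ hz)]
  rfl

lemma wordMap_singleton (n : Letter) (z : ℂ) : wordMap w [n] z = -1 / (z + n.1 * w) := by
  have : wordMatrix w [n] = letterMatrix w n := by simp [wordMatrix]
  rw [wordMap, this, moebius, letterMatrix_val]
  simp only [Matrix.of_apply, Matrix.cons_val', Matrix.cons_val_zero, Matrix.cons_val_one,
    Matrix.cons_val_fin_one, Complex.ofReal_zero, Complex.ofReal_one, Complex.ofReal_neg,
    Complex.ofReal_mul, Complex.ofReal_intCast, zero_mul, zero_add, neg_mul, one_mul]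
  rw [← neg_add, div_neg, neg_div]

lemma wordMap_cons (hw : 2 < w) (n : Letter) (ω : List Letter) {z : ℂ} (hz : ‖z‖ ≤ 1) :
    wordMap w (n :: ω) z = -1 / (wordMap w ω z + n.1 * w) := by
  rw [← wordMap_singleton, ← wordMap_append hw _ _ hz, List.singleton_append]

lemma le_norm_add_letter (hw : 2 < w) (n : Letter) {z : ℂ} (hz : ‖z‖ ≤ 1) :
    |(n.1 : ℝ)| * w - 1 ≤ ‖z + n.1 * w‖ := by
  have h : ‖((n.1 : ℂ) * w)‖ = |(n.1 : ℝ)| * w := by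
    rw [norm_mul, Complex.norm_real, Complex.norm_intCast, Real.norm_of_nonneg (by linarith)]
  have := norm_sub_norm_le ((n.1 : ℂ) * w) (-z)
  rw [norm_neg, h, sub_neg_eq_add, add_comm ((n.1 : ℂ) * w)] at this
  linarith

lemma norm_wordMap_le (hw : 2 < w) (ω : List Letter) {z : ℂ} (hz : ‖z‖ ≤ 1) :
    ‖wordMap w ω z‖ ≤ 1 := by
  induction ω with
  | nil => rwa [wordMap_nil]
  | cons n ω ih =>
    rw [wordMap_cons hw n ω hz, norm_div, norm_neg, norm_one]
    have := le_norm_add_letter hw n ih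
    have hn := n.one_le_abs
    rw [div_le_one (by nlinarith)]
    nlinarith

lemma norm_wordMap_cons_le (hw : 2 < w) (n : Letter) (ω : List Letter) {z : ℂ} (hz : ‖z‖ ≤ 1) :
    ‖wordMap w (n :: ω) z‖ ≤ 1 / (|(n.1 : ℝ)| * w - 1) := by
  rw [wordMap_cons hw n ω hz, norm_div, norm_neg, norm_one]
  have hn := n.one_le_abs
  exact one_div_le_one_div_of_le (by nlinarith)
    (le_norm_add_letter hw n (norm_wordMap_le hw ω hz))

lemma dist_wordMap (hw : 2 < w) (ω : List Letter) {z y : ℂ} (hz : ‖z‖ ≤ 1) (hy : ‖y‖ ≤ 1) :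
    dist (wordMap w ω z) (wordMap w ω y) = dist z y /
      (‖((wordMatrix w ω 1 0 : ℝ) : ℂ) * z + (wordMatrix w ω 1 1 : ℝ)‖ *
        ‖((wordMatrix w ω 1 0 : ℝ) : ℂ) * y + (wordMatrix w ω 1 1 : ℝ)‖) := by
  rw [dist_eq_norm, wordMap, wordMap,
    moebius_sub _ _ _ (denom_ne_zero hw ω hz) (denom_ne_zero hw ω hy), norm_div, norm_mul,
    dist_eq_norm]

lemma le_dist_wordMap (hw : 2 < w) (ω : List Letter) {z y : ℂ} (hz : ‖z‖ ≤ 1) (hy : ‖y‖ ≤ 1) :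
    1 / (4 * wordDenom w ω ^ 2) * dist z y ≤ dist (wordMap w ω z) (wordMap w ω y) := by
  rw [dist_wordMap hw ω hz hy, one_div_mul_eq_div]
  have h1 := norm_denom_le hw ω hz
  have h2 := norm_denom_le hw ω hy
  have h3 := norm_pos_iff.2 (denom_ne_zero hw ω hz)
  have h4 := norm_pos_iff.2 (denom_ne_zero hw ω hy)
  have h5 := one_le_wordDenom hw ω
  refine div_le_div_of_nonneg_left dist_nonneg (by positivity) ?_
  calc _ ≤ (2 * wordDenom w ω) * (2 * wordDenom w ω) := by gcongr
    _ = _ := by ring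

lemma dist_wordMap_le (hw : 2 < w) (ω : List Letter) {z y : ℂ} (hz : ‖z‖ ≤ 1) (hy : ‖y‖ ≤ 1) :
    dist (wordMap w ω z) (wordMap w ω y) ≤
      ((w - 1) / (w - 2)) ^ 2 / wordDenom w ω ^ 2 * dist z y := by
  rw [dist_wordMap hw ω hz hy]
  have h1 := le_norm_denom hw ω hz
  have h2 := le_norm_denom hw ω hy
  have hd := one_le_wordDenom hw ω
  have hw1 : 0 < w - 1 := by linarith
  have hw2 : 0 < w - 2 := by linarith
  have hq : 0 < (w - 2) / (w - 1) * wordDenom w ω := by positivity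
  calc _ ≤ dist z y / (((w - 2) / (w - 1) * wordDenom w ω) * ((w - 2) / (w - 1) * wordDenom w ω)) := by
        gcongr
    _ = _ := by field_simp

lemma eq_of_wordMap_eq (hw : 2 < w) {ω τ : List Letter} (hl : ω.length = τ.length) {z y : ℂ}
    (hz : ‖z‖ ≤ 1) (hy : ‖y‖ ≤ 1) (h : wordMap w ω z = wordMap w τ y) : ω = τ := by
  induction ω generalizing τ with
  | nil => exact (List.length_eq_zero_iff.1 hl.symm).symm
  | cons n ω ih =>
    obtain _ | ⟨m, τ⟩ := τ
    · simp at hl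
    rw [wordMap_cons hw n ω hz, wordMap_cons hw m τ hy, neg_div, neg_div, neg_inj, one_div, one_div,
      inv_inj] at h
    have hn : n.1 = m.1 := by
      by_contra hne
      have h1 : (1 : ℝ) ≤ |((n.1 - m.1 : ℤ) : ℝ)| := by
        exact_mod_cast Int.one_le_abs (sub_ne_zero.2 hne)
      have h2 : ((n.1 - m.1 : ℤ) : ℂ) * w = wordMap w τ y - wordMap w ω z := by
        push_cast
        linear_combination h
      have h3 := congrArg norm h2
      rw [norm_mul, Complex.norm_real, Complex.norm_intCast, Real.norm_of_nonneg (by linarith)] at h3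
      have h4 := norm_sub_le (wordMap w τ y) (wordMap w ω z)
      have h5 := norm_wordMap_le hw τ hy
      have h6 := norm_wordMap_le hw ω hz
      nlinarith
    rw [hn, add_left_inj] at h
    rw [Subtype.ext hn, ih (by simpa using hl) h]

/-! ### The limit set as the closure of the word centres -/

/-- The closure of the set of images of `0` under all words. -/
noncomputable def wordLimit (w : ℝ) : Set ℂ :=
  closure (Set.range fun ω => wordMap w ω 0)

lemma norm_wordMap_zero_le (hw : 2 < w) (ω : List Letter) : ‖wordMap w ω 0‖ ≤ 1 / (w - 1) := by
  have hw1 : 0 < w - 1 := by linarith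
  cases ω with
  | nil => simpa [wordMap_nil] using hw1.le
  | cons n ω =>
    refine (norm_wordMap_cons_le hw n ω (by simp)).trans ?_
    have := n.one_le_abs
    exact one_div_le_one_div_of_le hw1 (by nlinarith)

lemma wordMap_conj (ω : List Letter) (z : ℂ) :
    wordMap w ω ((starRingEnd ℂ) z) = (starRingEnd ℂ) (wordMap w ω z) := by
  simp [wordMap, moebius]

lemma wordMap_zero_im (ω : List Letter) : (wordMap w ω 0).im = 0 := by
  rw [← Complex.conj_eq_iff_im, ← wordMap_conj, map_zero]

lemma norm_le_of_mem_wordLimit (hw : 2 < w) {z : ℂ} (hz : z ∈ wordLimit w) :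
    ‖z‖ ≤ 1 / (w - 1) := by
  have hsub : wordLimit w ⊆ Metric.closedBall 0 (1 / (w - 1)) := by
    refine closure_minimal ?_ Metric.isClosed_closedBall
    rintro _ ⟨ω, rfl⟩
    simpa using norm_wordMap_zero_le hw ω
  simpa using hsub hz

lemma norm_le_one_of_mem_wordLimit (hw : 2 < w) {z : ℂ} (hz : z ∈ wordLimit w) : ‖z‖ ≤ 1 := by
  refine (norm_le_of_mem_wordLimit hw hz).trans ?_
  rw [div_le_one (by linarith)]
  linarith

lemma im_eq_zero_of_mem_wordLimit {z : ℂ} (hz : z ∈ wordLimit w) : z.im = 0 := by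
  have hsub : wordLimit w ⊆ {z : ℂ | z.im = 0} := by
    refine closure_minimal ?_ (isClosed_eq Complex.continuous_im continuous_const)
    rintro _ ⟨ω, rfl⟩
    exact wordMap_zero_im ω
  exact hsub hz

lemma isCompact_wordLimit (hw : 2 < w) : IsCompact (wordLimit w) := by
  refine (isCompact_closedBall (0 : ℂ) (1 / (w - 1))).of_isClosed_subset isClosed_closure ?_
  intro z hz
  simpa using norm_le_of_mem_wordLimit hw hz

lemma wordLimit_nonempty : (wordLimit w).Nonempty :=
  ⟨_, subset_closure ⟨[], rfl⟩⟩

lemma continuousOn_wordMap (hw : 2 < w) (ω : List Letter) :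
    ContinuousOn (wordMap w ω) (wordLimit w) := by
  refine ContinuousOn.div (by fun_prop) (by fun_prop) fun z hz => ?_
  exact denom_ne_zero hw ω (norm_le_one_of_mem_wordLimit hw hz)

lemma mapsTo_wordMap (hw : 2 < w) (ω : List Letter) :
    Set.MapsTo (wordMap w ω) (wordLimit w) (wordLimit w) := by
  refine Set.MapsTo.closure_of_continuousOn ?_ (continuousOn_wordMap hw ω)
  rintro _ ⟨τ, rfl⟩
  exact ⟨ω ++ τ, wordMap_append hw ω τ (by simp)⟩

lemma wordMap_mem_orbit (ω : List Letter) :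
    wordMap w ω Complex.I ∈ (fun γ => moebius γ Complex.I) ''
      (heckeGroup w : Set (Matrix.SpecialLinearGroup (Fin 2) ℝ)) :=
  ⟨_, wordMatrix_mem_heckeGroup w ω, rfl⟩

lemma wordMap_zero_mem_limitSet (hw : 2 < w) (ω : List Letter) :
    wordMap w ω 0 ∈ limitSet (heckeGroup w) := by
  have hI : ‖Complex.I‖ ≤ 1 := by simp
  let n : ℕ → Letter := fun k => ⟨k + 1, by omega⟩
  have hn : ∀ k, |((n k).1 : ℝ)| = k + 1 := by
    intro k
    simp only [n]
    push_cast
    exact abs_of_nonneg (by positivity)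
  let u : ℕ → ℂ := fun k => wordMap w (ω ++ [n k]) Complex.I
  have hu : Filter.Tendsto u Filter.atTop (nhds (wordMap w ω 0)) := by
    rw [tendsto_iff_dist_tendsto_zero]
    have hlim := (tendsto_one_div_add_atTop_nhds_zero_nat (𝕜 := ℝ)).const_mul
      (((w - 1) / (w - 2)) ^ 2 / wordDenom w ω ^ 2)
    rw [mul_zero] at hlim
    refine squeeze_zero (fun _ => dist_nonneg) (fun k => ?_) hlim
    simp only [u]
    rw [wordMap_append hw _ _ hI]
    refine (dist_wordMap_le hw ω (norm_wordMap_le hw _ hI) (by simp)).trans ?_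
    refine mul_le_mul_of_nonneg_left ?_ (by positivity)
    rw [dist_zero_right]
    refine (norm_wordMap_cons_le hw _ _ hI).trans ?_
    rw [hn]
    exact one_div_le_one_div_of_le (by positivity) (by nlinarith [(Nat.cast_nonneg k : (0 : ℝ) ≤ k)])
  have hne : ∀ k, u k ≠ wordMap w ω 0 := by
    intro k h
    have h1 := le_dist_wordMap hw ω (norm_wordMap_le hw [n k] hI) (y := 0) (by simp)
    rw [← wordMap_append hw _ _ hI, show wordMap w (ω ++ [n k]) Complex.I = wordMap w ω 0 from h,
      dist_self, dist_zero_right] at h1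
    have h2 := one_le_wordDenom hw ω
    have h3 : wordMap w [n k] Complex.I ≠ 0 := by
      rw [wordMap_singleton]
      refine div_ne_zero (by simp) ?_
      rw [← norm_pos_iff]
      refine lt_of_lt_of_le ?_ (le_norm_add_letter hw (n k) hI)
      nlinarith [(n k).one_le_abs]
    have h4 := norm_pos_iff.2 h3
    have h5 : 0 < 1 / (4 * wordDenom w ω ^ 2) * ‖wordMap w [n k] Complex.I‖ := by positivity
    linarith
  refine accPt_iff_frequently.2 ?_
  exact hu.frequently (Filter.Frequently.of_forall fun k => ⟨hne k, wordMap_mem_orbit _⟩)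

lemma wordLimit_subset_limitSet (hw : 2 < w) : wordLimit w ⊆ limitSet (heckeGroup w) := by
  refine closure_minimal ?_ (isClosed_derivedSet _)
  rintro _ ⟨ω, rfl⟩
  exact wordMap_zero_mem_limitSet hw ω

lemma exists_eq_wordMap_add (hw : 2 < w) {γ : Matrix.SpecialLinearGroup (Fin 2) ℝ}
    (hγ : γ ∈ heckeGroup w) :
    ∃ (m : ℤ) (ω : List Letter), moebius γ Complex.I = wordMap w ω Complex.I + m * w := by
  have hI : ‖Complex.I‖ ≤ 1 := by simp
  have hS : ∀ z : ℂ, (∃ (m : ℤ) (ω : List Letter), z = wordMap w ω Complex.I + m * w) →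
      ∃ (m : ℤ) (ω : List Letter), -1 / z = wordMap w ω Complex.I + m * w := by
    rintro z ⟨m, ω, rfl⟩
    by_cases hm : m = 0
    · subst hm
      cases ω with
      | nil => exact ⟨0, [], by simp [wordMap_nil, div_eq_mul_inv]⟩
      | cons n ω =>
        refine ⟨n.1, ω, ?_⟩
        rw [wordMap_cons hw n ω hI]
        simp
    · refine ⟨0, ⟨m, hm⟩ :: ω, ?_⟩
      rw [wordMap_cons hw _ ω hI]
      simp
  have hden : ∀ γ : Matrix.SpecialLinearGroup (Fin 2) ℝ,
      ((γ 1 0 : ℝ) : ℂ) * Complex.I + (γ 1 1 : ℝ) ≠ 0 :=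
    fun γ => denom_ne_zero_of_im γ (by simp)
  have hSinv : ∀ z, moebius S⁻¹ z = -1 / z := by
    intro z
    have : (S⁻¹ : Matrix.SpecialLinearGroup (Fin 2) ℝ).1 = !![0, -1; 1, 0] := by
      rw [Matrix.SpecialLinearGroup.SL2_inv_expl]
      simp [S_val]
      rfl
    simp [moebius, this]
  induction hγ using Subgroup.closure_induction_left with
  | one => exact ⟨0, [], by simp [wordMap_nil, moebius]⟩
  | mul_left x hx y hy ih =>
    rw [moebius_mul _ _ _ (hden y)]
    rcases hx with rfl | rfl
    · rw [moebius_S]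
      exact hS _ ih
    · obtain ⟨m, ω, h⟩ := ih
      exact ⟨m + 1, ω, by rw [moebius_T, h]; push_cast; ring⟩
  | inv_mul_cancel x hx y hy ih =>
    rw [moebius_mul _ _ _ (hden y)]
    rcases hx with rfl | rfl
    · rw [hSinv]
      exact hS _ ih
    · obtain ⟨m, ω, h⟩ := ih
      exact ⟨m - 1, ω, by rw [← T_neg, moebius_T, h]; push_cast; ring⟩

lemma dist_wordMap_I_zero_le (hw : 2 < w) (ω : List Letter) :
    dist (wordMap w ω Complex.I) (wordMap w ω 0) ≤
      4 * ((w - 1) / (w - 2)) ^ 2 * |(wordMap w ω Complex.I).im| := by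
  have hI : ‖Complex.I‖ ≤ 1 := by simp
  have h1 := dist_wordMap_le hw ω hI (y := 0) (by simp)
  have h2 := le_dist_wordMap hw ω hI (y := (starRingEnd ℂ) Complex.I) (by simp)
  rw [wordMap_conj, Complex.dist_self_conj, Complex.dist_self_conj] at h2
  rw [dist_zero_right, Complex.norm_I, mul_one] at h1
  rw [Complex.I_im, abs_one] at h2
  refine h1.trans ?_
  have hd := one_le_wordDenom hw ω
  have h3 : 1 / wordDenom w ω ^ 2 ≤ 4 * |(wordMap w ω Complex.I).im| := by
    have : 1 / (4 * wordDenom w ω ^ 2) * (2 * 1) = 1 / wordDenom w ω ^ 2 / 2 := by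
      field_simp
      norm_num
    rw [this] at h2
    linarith
  calc ((w - 1) / (w - 2)) ^ 2 / wordDenom w ω ^ 2
      = ((w - 1) / (w - 2)) ^ 2 * (1 / wordDenom w ω ^ 2) := by ring
    _ ≤ ((w - 1) / (w - 2)) ^ 2 * (4 * |(wordMap w ω Complex.I).im|) := by gcongr
    _ = _ := by ring

lemma limitSet_inter_strip (hw : 2 < w) :
    limitSet (heckeGroup w) ∩ {x : ℂ | x.im = 0 ∧ -1 < x.re ∧ x.re < 1} = wordLimit w := by
  have hI : ‖Complex.I‖ ≤ 1 := by simp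
  apply Set.Subset.antisymm
  · rintro x ⟨hx, him, hre1, hre2⟩
    rw [wordLimit, Metric.mem_closure_iff]
    intro ε hε
    set K := 4 * ((w - 1) / (w - 2)) ^ 2 with hK
    have hK0 : 0 ≤ K := by positivity
    have hre : |x.re| < 1 := abs_lt.2 ⟨hre1, hre2⟩
    have hη : 0 < min (1 - |x.re|) (ε / (K + 1)) := lt_min (by linarith) (by positivity)
    obtain ⟨y, ⟨γ, hγ, rfl⟩, hy⟩ := Metric.mem_closure_iff.1 (mem_closure_iff_clusterPt.2
      (AccPt.clusterPt hx)) _ hη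
    obtain ⟨m, ω, hmω⟩ := exists_eq_wordMap_add hw hγ
    simp only [hmω] at hy
    have hy1 := hy.trans_le (min_le_left _ _)
    have hy2 := hy.trans_le (min_le_right _ _)
    have hm : m = 0 := by
      by_contra hm
      have h1 : (1 : ℝ) ≤ |(m : ℝ)| := by exact_mod_cast Int.one_le_abs hm
      have h2 := le_norm_add_letter hw ⟨m, hm⟩ (norm_wordMap_le hw ω hI)
      have h3 := Complex.abs_re_le_norm (x - (wordMap w ω Complex.I + m * w))
      have h4 : (wordMap w ω Complex.I + m * w).re = (wordMap w ω Complex.I).re + m * w := by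
        simp
      have h5 := (Complex.abs_re_le_norm _).trans (norm_wordMap_le hw ω hI)
      rw [Complex.sub_re, h4] at h3
      rw [dist_eq_norm] at hy1
      have h6 : |(m : ℝ) * w| = |(m : ℝ)| * w := by
        rw [abs_mul, abs_of_pos (by linarith : (0 : ℝ) < w)]
      have h7 : |(m : ℝ) * w| ≤ |x.re - ((wordMap w ω Complex.I).re + m * w)| + |x.re| +
          |(wordMap w ω Complex.I).re| := by
        calc |(m : ℝ) * w| = |-(x.re - ((wordMap w ω Complex.I).re + m * w)) + x.re +
              -(wordMap w ω Complex.I).re| := by congr 1; ring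
          _ ≤ _ := by
            refine (abs_add_le _ _).trans ?_
            rw [abs_neg]
            gcongr
            refine (abs_add_le _ _).trans ?_
            rw [abs_neg]
      nlinarith
    subst hm
    rw [Int.cast_zero, zero_mul, add_zero] at hy2
    refine ⟨_, ⟨ω, rfl⟩, ?_⟩
    have h1 : |(wordMap w ω Complex.I).im| ≤ dist x (wordMap w ω Complex.I) := by
      rw [dist_eq_norm]
      refine le_trans ?_ (Complex.abs_im_le_norm _)
      rw [Complex.sub_im, him, zero_sub, abs_neg]
    calc dist x (wordMap w ω 0)
        ≤ dist x (wordMap w ω Complex.I) + dist (wordMap w ω Complex.I) (wordMap w ω 0) :=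
          dist_triangle _ _ _
      _ ≤ dist x (wordMap w ω Complex.I) + K * dist x (wordMap w ω Complex.I) := by
          gcongr
          exact (dist_wordMap_I_zero_le hw ω).trans (by gcongr)
      _ = (K + 1) * dist x (wordMap w ω Complex.I) := by ring
      _ < (K + 1) * (ε / (K + 1)) := by gcongr
      _ = ε := mul_div_cancel₀ _ (by positivity)
  · intro x hx
    have h1 := norm_le_of_mem_wordLimit hw hx
    have h2 : 1 / (w - 1) < 1 := by
      rw [div_lt_one (by linarith)]
      linarith
    have h3 := abs_lt.1 (((Complex.abs_re_le_norm x).trans h1).trans_lt h2)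
    exact ⟨wordLimit_subset_limitSet hw hx, im_eq_zero_of_mem_wordLimit hx, h3⟩

/-! ### Sums of word denominators and the upper volume bound -/

lemma sum_rpow_le_one (hw : 2 < w) {t : NNReal} (ht : dimH (wordLimit w) < t) {k : ℕ}
    (A : Finset (List Letter)) (hA : ∀ ω ∈ A, ω.length = k) :
    ∑ ω ∈ A, (1 / (4 * wordDenom w ω ^ 2)) ^ (t : ℝ) ≤ 1 := by
  have hpos : ∀ ω, 0 < 1 / (4 * wordDenom w ω ^ 2) := fun ω => by
    have := one_le_wordDenom hw ω
    positivity
  rcases le_or_gt A.card 1 with hc | hc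
  · have hle : ∀ ω ∈ A, (1 / (4 * wordDenom w ω ^ 2)) ^ (t : ℝ) ≤ 1 := fun ω _ => by
      refine Real.rpow_le_one (hpos ω).le ?_ t.2
      have := one_le_wordDenom hw ω
      rw [div_le_one (by positivity)]
      nlinarith
    refine (Finset.sum_le_card_nsmul A _ 1 hle).trans ?_
    simpa using hc
  · by_contra! h
    refine absurd (le_dimH_of_one_le_sum_rpow hc (f := wordMap w) (fun ω _ => hpos ω)
      (isCompact_wordLimit hw) wordLimit_nonempty (fun ω _ => continuousOn_wordMap hw ω)
      (fun ω _ => mapsTo_wordMap hw ω) (fun ω hω τ hτ x hx y hy hxy => ?_)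
      (fun ω _ x hx y hy => ?_) (t := t) ?_ h.le) (not_le.2 ht)
    · exact eq_of_wordMap_eq hw ((hA ω hω).trans (hA τ hτ).symm)
        (norm_le_one_of_mem_wordLimit hw hx) (norm_le_one_of_mem_wordLimit hw hy) hxy
    · exact le_dist_wordMap hw ω (norm_le_one_of_mem_wordLimit hw hx)
        (norm_le_one_of_mem_wordLimit hw hy)
    · exact_mod_cast pos_of_gt ht

lemma summable_wordDenom_rpow (hw : 2 < w) {t : ℝ} (ht : (dimH (wordLimit w)).toReal < t) :
    Summable fun ω => wordDenom w ω ^ (-(2 * t)) := by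
  obtain ⟨u, hu, hut⟩ := exists_between ht
  have hu0 : 0 < u := ENNReal.toReal_nonneg.trans_lt hu
  lift u to NNReal using hu0.le
  have hdim : dimH (wordLimit w) < u := by
    rw [← ENNReal.toReal_lt_toReal (Real.dimH_lt_top _).ne ENNReal.coe_ne_top]
    simpa using hu
  have hw1 : 1 < w - 1 := by linarith
  set q : ℝ := (w - 1) ^ (-(2 * (t - u))) with hq
  have hq0 : 0 ≤ q := by positivity
  have hq1 : q < 1 := Real.rpow_lt_one_of_one_lt_of_neg hw1 (by linarith)
  have hgeom : Summable fun k : ℕ => (4 : ℝ) ^ (u : ℝ) * q ^ k :=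
    (summable_geometric_of_lt_one hq0 hq1).mul_left _
  have hterm : ∀ ω, wordDenom w ω ^ (-(2 * t)) ≤
      (4 : ℝ) ^ (u : ℝ) * q ^ ω.length * (1 / (4 * wordDenom w ω ^ 2)) ^ (u : ℝ) := by
    intro ω
    have hd := one_le_wordDenom hw ω
    have hd0 : 0 < wordDenom w ω := by linarith
    have h1 : wordDenom w ω ^ (-(2 * t)) =
        wordDenom w ω ^ (-(2 * (t - u))) * wordDenom w ω ^ (-(2 * (u : ℝ))) := by
      rw [← Real.rpow_add hd0]
      ring_nf
    have h2 : (1 / (4 * wordDenom w ω ^ 2)) ^ (u : ℝ) =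
        ((4 : ℝ) ^ (u : ℝ))⁻¹ * wordDenom w ω ^ (-(2 * (u : ℝ))) := by
      rw [one_div, Real.inv_rpow (by positivity), Real.mul_rpow (by positivity) (by positivity),
        mul_inv, Real.rpow_neg hd0.le, Real.rpow_mul hd0.le, Real.rpow_two]
    have h3 : wordDenom w ω ^ (-(2 * (t - u))) ≤ q ^ ω.length := by
      rw [hq, Real.rpow_pow_comm (by linarith)]
      exact Real.rpow_le_rpow_of_nonpos (pow_pos (by linarith) _) (wordMatrix_bounds hw ω).2
        (by linarith)
    rw [h1, h2]
    have h4 : (0 : ℝ) < 4 ^ (u : ℝ) := by positivity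
    calc _ ≤ q ^ ω.length * wordDenom w ω ^ (-(2 * (u : ℝ))) := by gcongr
      _ = _ := by field_simp
  refine summable_of_sum_le (c := ∑' k : ℕ, (4 : ℝ) ^ (u : ℝ) * q ^ k)
    (fun ω => Real.rpow_nonneg (abs_nonneg _) _) fun A => ?_
  calc ∑ ω ∈ A, wordDenom w ω ^ (-(2 * t))
      ≤ ∑ ω ∈ A, (4 : ℝ) ^ (u : ℝ) * q ^ ω.length * (1 / (4 * wordDenom w ω ^ 2)) ^ (u : ℝ) :=
        Finset.sum_le_sum fun ω _ => hterm ω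
    _ = ∑ k ∈ A.image List.length, ∑ ω ∈ A with ω.length = k,
          (4 : ℝ) ^ (u : ℝ) * q ^ ω.length * (1 / (4 * wordDenom w ω ^ 2)) ^ (u : ℝ) :=
        (Finset.sum_fiberwise_of_maps_to (fun ω hω => Finset.mem_image_of_mem _ hω) _).symm
    _ ≤ ∑ k ∈ A.image List.length, (4 : ℝ) ^ (u : ℝ) * q ^ k := by
        refine Finset.sum_le_sum fun k _ => ?_
        have h1 : ∑ ω ∈ A with ω.length = k,
            (4 : ℝ) ^ (u : ℝ) * q ^ ω.length * (1 / (4 * wordDenom w ω ^ 2)) ^ (u : ℝ) =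
            (4 : ℝ) ^ (u : ℝ) * q ^ k * ∑ ω ∈ A with ω.length = k,
              (1 / (4 * wordDenom w ω ^ 2)) ^ (u : ℝ) := by
          rw [Finset.mul_sum]
          refine Finset.sum_congr rfl fun ω hω => ?_
          rw [(Finset.mem_filter.1 hω).2]
        rw [h1]
        exact mul_le_of_le_one_right (by positivity)
          (sum_rpow_le_one hw hdim _ fun ω hω => (Finset.mem_filter.1 hω).2)
    _ ≤ _ := hgeom.sum_le_tsum _ fun k _ => by positivity

lemma one_lt_two_mul_of_dimH_lt (hw : 2 < w) {t : ℝ} (ht : (dimH (wordLimit w)).toReal < t) :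
    1 < 2 * t := by
  let g : ℕ → List Letter := fun n => [⟨(n + 1 : ℕ), by omega⟩]
  have hg : Function.Injective g := by
    intro a b hab
    simpa [g] using hab
  have h1 := (summable_wordDenom_rpow hw ht).comp_injective hg
  have hw0 : (0 : ℝ) < w := by linarith
  have h2 : ((fun ω => wordDenom w ω ^ (-(2 * t))) ∘ g) =
      fun n : ℕ => ((n + 1 : ℕ) : ℝ) ^ (-(2 * t)) * w ^ (-(2 * t)) := by
    funext n
    simp only [Function.comp_apply, g]
    rw [wordDenom_singleton hw, ← Real.mul_rpow (by positivity) hw0.le, Int.cast_natCast,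
      abs_of_nonneg (by positivity)]
  rw [h2, summable_mul_right_iff (by positivity),
    summable_nat_add_iff 1 (f := fun n : ℕ => (n : ℝ) ^ (-(2 * t))), Real.summable_nat_rpow] at h1
  linarith

lemma exists_prefix (ω : List Letter) {s : ℝ} (hs : s < 1) :
    wordDenom w ω * s < 1 ∨ ∃ (ω' : List Letter) (n : Letter) (τ : List Letter),
      ω = ω' ++ n :: τ ∧ wordDenom w ω' * s < 1 ∧ 1 ≤ wordDenom w (ω' ++ [n]) * s := by
  induction ω using List.reverseRecOn with
  | nil =>
    left
    simpa [wordDenom, wordMatrix] using hs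
  | append_singleton ω n ih =>
    rcases ih with h | ⟨ω', m, τ, rfl, h1, h2⟩
    · rcases lt_or_ge (wordDenom w (ω ++ [n]) * s) 1 with h' | h'
      · exact Or.inl h'
      · exact Or.inr ⟨ω, n, [], rfl, h, h'⟩
    · exact Or.inr ⟨ω', m, τ ++ [n], by simp, h1, h2⟩

lemma exists_dist_wordMap_zero_le (hw : 2 < w) (ω : List Letter) {s : ℝ} (hs0 : 0 < s)
    (hs : s < 1) : ∃ ω', wordDenom w ω' * s < 1 ∧
      dist (wordMap w ω 0) (wordMap w ω' 0) ≤
        3 * ((w - 1) / (w - 2)) ^ 2 * s / wordDenom w ω' := by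
  rcases exists_prefix (w := w) ω hs with h | ⟨ω', n, τ, rfl, h1, h2⟩
  · refine ⟨ω, h, ?_⟩
    have := one_le_wordDenom hw ω
    rw [dist_self]
    positivity
  · refine ⟨ω', h1, ?_⟩
    have hd := one_le_wordDenom hw ω'
    have hn := n.one_le_abs
    rw [wordMap_append hw _ _ (by simp)]
    refine (dist_wordMap_le hw ω' (norm_wordMap_le hw _ (by simp)) (by simp)).trans ?_
    rw [dist_zero_right]
    have h3 : ‖wordMap w (n :: τ) 0‖ ≤ 3 * (wordDenom w ω' * s) := by
      refine (norm_wordMap_cons_le hw n τ (by simp)).trans ?_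
      have h4 := wordDenom_concat_le hw ω' n
      have h5 : 1 ≤ (|(n.1 : ℝ)| * w + 1) * (wordDenom w ω' * s) := by nlinarith
      have h6 : 2 < |(n.1 : ℝ)| * w := by nlinarith
      rw [div_le_iff₀ (by linarith)]
      have h7 : 0 < wordDenom w ω' * s := by positivity
      nlinarith
    calc _ ≤ ((w - 1) / (w - 2)) ^ 2 / wordDenom w ω' ^ 2 * (3 * (wordDenom w ω' * s)) := by gcongr
      _ = _ := by field_simp

lemma volume_box (a r h : ℝ) :
    volume {z : ℂ | |z.re - a| ≤ r ∧ |z.im| ≤ h} = ENNReal.ofReal (2 * r) * ENNReal.ofReal (2 * h) := by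
  have : {z : ℂ | |z.re - a| ≤ r ∧ |z.im| ≤ h} =
      Complex.measurableEquivRealProd ⁻¹' (Metric.closedBall a r ×ˢ Metric.closedBall 0 h) := by
    ext z
    simp [Real.dist_eq, Complex.measurableEquivRealProd]
  rw [this, Complex.volume_preserving_equiv_real_prod.measure_preimage
    (Metric.isClosed_closedBall.measurableSet.prod
      Metric.isClosed_closedBall.measurableSet).nullMeasurableSet, Measure.volume_eq_prod,
    Measure.prod_prod, Real.volume_closedBall, Real.volume_closedBall]

lemma thickening_wordLimit_subset (hw : 2 < w) {h s : ℝ} (hs0 : 0 < s) (hs : s < 1)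
    (hsq : s ^ 2 = h) :
    Metric.thickening h (wordLimit w) ⊆ ⋃ ω, {z : ℂ | wordDenom w ω * s < 1 ∧
      |z.re - (wordMap w ω 0).re| ≤ (3 * ((w - 1) / (w - 2)) ^ 2 + 1) * s / wordDenom w ω ∧
      |z.im| ≤ h} := by
  intro z hz
  rw [wordLimit, Metric.thickening_closure, Metric.mem_thickening_iff] at hz
  obtain ⟨_, ⟨ω, rfl⟩, hzω⟩ := hz
  obtain ⟨ω', h1, h2⟩ := exists_dist_wordMap_zero_le hw ω hs0 hs
  have hd := one_le_wordDenom hw ω'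
  have h3 : h ≤ s / wordDenom w ω' := by
    rw [le_div_iff₀ (by linarith), ← hsq]
    nlinarith
  refine Set.mem_iUnion.2 ⟨ω', h1, ?_, ?_⟩
  · rw [← Complex.sub_re]
    refine (Complex.abs_re_le_norm _).trans ?_
    rw [← dist_eq_norm]
    calc dist z (wordMap w ω' 0) ≤ dist z (wordMap w ω 0) + dist (wordMap w ω 0) (wordMap w ω' 0) :=
          dist_triangle _ _ _
      _ ≤ s / wordDenom w ω' + 3 * ((w - 1) / (w - 2)) ^ 2 * s / wordDenom w ω' := by
          gcongr
          exact hzω.le.trans h3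
      _ = _ := by ring
  · have h4 := (Complex.abs_im_le_norm (z - wordMap w ω 0)).trans_lt (by rwa [← dist_eq_norm])
    rw [Complex.sub_im, wordMap_zero_im, sub_zero] at h4
    exact h4.le

lemma exists_volume_thickening_le (hw : 2 < w) {t : ℝ} (ht : (dimH (wordLimit w)).toReal < t) :
    ∃ C : ℝ, 0 ≤ C ∧ ∀ h : ℝ, 0 < h → h < 1 →
      (volume (Metric.thickening h (wordLimit w))).toReal ≤ C * h ^ (2 - t) := by
  have hsum := summable_wordDenom_rpow hw ht
  have ht2 := one_lt_two_mul_of_dimH_lt hw ht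
  set K : ℝ := 3 * ((w - 1) / (w - 2)) ^ 2 + 1 with hK
  have hK0 : 0 < K := by positivity
  have hnn : ∀ ω, 0 ≤ wordDenom w ω ^ (-(2 * t)) := fun ω => Real.rpow_nonneg (abs_nonneg _) _
  refine ⟨4 * K * ∑' ω, wordDenom w ω ^ (-(2 * t)), mul_nonneg (by positivity) (tsum_nonneg hnn),
    fun h hh0 hh1 => ?_⟩
  have hs0 : 0 < √h := Real.sqrt_pos.2 hh0
  have hs1 : √h < 1 := by rw [Real.sqrt_lt' one_pos]; simpa using hh1
  have hsq : √h ^ 2 = h := Real.sq_sqrt hh0.le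
  have hbox : ∀ ω, volume {z : ℂ | wordDenom w ω * √h < 1 ∧
      |z.re - (wordMap w ω 0).re| ≤ K * √h / wordDenom w ω ∧ |z.im| ≤ h} ≤
      ENNReal.ofReal (4 * K * h ^ (2 - t) * wordDenom w ω ^ (-(2 * t))) := by
    intro ω
    by_cases hω : wordDenom w ω * √h < 1
    · simp only [hω, true_and]
      have hd := one_le_wordDenom hw ω
      have hd0 : 0 < wordDenom w ω := by linarith
      rw [volume_box, ← ENNReal.ofReal_mul (by positivity)]
      refine ENNReal.ofReal_le_ofReal ?_
      have hrw : h ^ (2 - t) = √h ^ (4 - 2 * t) := by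
        conv_lhs => rw [← hsq, ← Real.rpow_two, ← Real.rpow_mul hs0.le]
        ring_nf
      have key : √h * h / wordDenom w ω ≤ h ^ (2 - t) * wordDenom w ω ^ (-(2 * t)) := by
        have h1 : √h * h / wordDenom w ω * (wordDenom w ω * √h) ^ (-(2 * t - 1)) =
            h ^ (2 - t) * wordDenom w ω ^ (-(2 * t)) := by
          have e1 : √h * h = √h ^ (3 : ℝ) := by
            rw [show (3 : ℝ) = ((3 : ℕ) : ℝ) by norm_num, Real.rpow_natCast]
            linear_combination (-√h) * hsq
          rw [e1, hrw, Real.mul_rpow hd0.le hs0.le, div_eq_mul_inv, ← Real.rpow_neg_one (wordDenom w ω),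
            show (4 - 2 * t : ℝ) = 3 + -(2 * t - 1) by ring, Real.rpow_add hs0,
            show -(2 * t) = -1 + -(2 * t - 1) by ring, Real.rpow_add hd0]
          ring_nf
        rw [← h1]
        refine le_mul_of_one_le_right (by positivity) ?_
        exact Real.one_le_rpow_of_pos_of_le_one_of_nonpos (by positivity) hω.le (by linarith)
      calc 2 * (K * √h / wordDenom w ω) * (2 * h) = 4 * K * (√h * h / wordDenom w ω) := by ring
        _ ≤ 4 * K * (h ^ (2 - t) * wordDenom w ω ^ (-(2 * t))) := by gcongr
        _ = _ := by ring
    · simp [hω]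
  have hle : volume (Metric.thickening h (wordLimit w)) ≤
      ENNReal.ofReal (4 * K * h ^ (2 - t) * ∑' ω, wordDenom w ω ^ (-(2 * t))) := by
    refine (measure_mono (thickening_wordLimit_subset hw hs0 hs1 hsq)).trans ?_
    refine (measure_iUnion_le _).trans ?_
    refine (ENNReal.tsum_le_tsum hbox).trans ?_
    rw [← tsum_mul_left, ENNReal.ofReal_tsum_of_nonneg _ (hsum.mul_left _)]
    exact fun ω => mul_nonneg (by positivity) (hnn ω)
  refine (ENNReal.toReal_le_of_le_ofReal ?_ hle).trans (le_of_eq (by ring))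
  exact mul_nonneg (by positivity) (tsum_nonneg hnn)

lemma eventually_volume_thickening_le_rpow (hw : 2 < w) {t : ℝ}
    (ht : (dimH (wordLimit w)).toReal < t) :
    ∀ᶠ h : ℝ in nhdsWithin 0 (Set.Ioi 0),
      (volume (Metric.thickening h (wordLimit w))).toReal ≤ h ^ (2 - t) := by
  obtain ⟨u, hu, hut⟩ := exists_between ht
  obtain ⟨C, hC, hvol⟩ := exists_volume_thickening_le hw hu
  have hlim : Filter.Tendsto (fun h : ℝ => C * h ^ (t - u)) (nhdsWithin 0 (Set.Ioi 0))
      (nhds 0) := by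
    have h1 : Filter.Tendsto (fun h : ℝ => C * h ^ (t - u)) (nhds 0) (nhds (C * 0 ^ (t - u))) :=
      ((Real.continuousAt_rpow_const _ _ (Or.inr (by linarith))).const_mul C).tendsto
    rw [Real.zero_rpow (by linarith), mul_zero] at h1
    exact h1.mono_left nhdsWithin_le_nhds
  have hlt : ∀ᶠ h : ℝ in nhdsWithin 0 (Set.Ioi 0), h < 1 :=
    nhdsWithin_le_nhds (Iio_mem_nhds one_pos)
  filter_upwards [hlim.eventually_le_const one_pos, hlt, self_mem_nhdsWithin] with h h1 h2 h3
  have h3 : 0 < h := h3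
  refine (hvol h h3 h2).trans ?_
  calc C * h ^ (2 - u) = (C * h ^ (t - u)) * h ^ (2 - t) := by
        rw [mul_assoc, ← Real.rpow_add h3]
        ring_nf
    _ ≤ 1 * h ^ (2 - t) := by gcongr
    _ = _ := one_mul _

end

theorem minkowski_eq_hausdorff (w : ℝ) (hw : 2 < w)
    (Λ₀ : Set ℂ)
    (hΛ₀ : Λ₀ = limitSet (heckeGroup w) ∩ {x : ℂ | x.im = 0 ∧ -1 < x.re ∧ x.re < 1}) :
    Filter.Tendsto
      (fun h : ℝ => Real.log ((volume (Metric.thickening h Λ₀)).toReal) / Real.log h)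
      (nhdsWithin 0 (Set.Ioi 0))
      (nhds (2 - (dimH Λ₀).toReal)) := by
  rw [limitSet_inter_strip hw] at hΛ₀
  subst hΛ₀
  set δ := (dimH (wordLimit w)).toReal with hδ
  have hδ0 : 0 < δ := by
    by_contra! hneg
    have := one_lt_two_mul_of_dimH_lt hw (t := 1 / 4) (by linarith)
    linarith
  have hlt : ∀ᶠ h : ℝ in nhdsWithin 0 (Set.Ioi 0), h < 1 :=
    nhdsWithin_le_nhds (Iio_mem_nhds one_pos)
  have hlower : ∀ t, 0 ≤ t → t < δ → ∀ᶠ h : ℝ in nhdsWithin 0 (Set.Ioi 0),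
      h ^ (2 - t) ≤ (volume (Metric.thickening h (wordLimit w))).toReal := by
    intro t ht0 ht
    lift t to NNReal using ht0
    refine eventually_rpow_le_volume_thickening (isCompact_wordLimit hw) ?_
    rw [← ENNReal.toReal_lt_toReal ENNReal.coe_ne_top (Real.dimH_lt_top _).ne]
    simpa using ht
  refine tendsto_order.2 ⟨fun a ha => ?_, fun a ha => ?_⟩
  · obtain ⟨t, ht1, ht2⟩ := exists_between (show δ < 2 - a by linarith)
    filter_upwards [eventually_volume_thickening_le_rpow hw ht1, hlower 0 le_rfl hδ0, hlt,
      self_mem_nhdsWithin] with h h1 h2 h3 h4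
    have h4 : 0 < h := h4
    have hlog : Real.log h < 0 := Real.log_neg h4 h3
    have h5 := Real.log_le_log ((Real.rpow_pos_of_pos h4 _).trans_le h2) h1
    rw [Real.log_rpow h4] at h5
    rw [lt_div_iff_of_neg hlog]
    nlinarith
  · obtain ⟨t, ht1, ht2⟩ := exists_between (show max 0 (2 - a) < δ from max_lt hδ0 (by linarith))
    filter_upwards [hlower t ((le_max_left _ _).trans ht1.le) ht2, hlt,
      self_mem_nhdsWithin] with h h1 h3 h4
    have h4 : 0 < h := h4
    have hlog : Real.log h < 0 := Real.log_neg h4 h3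
    have h5 := Real.log_le_log (Real.rpow_pos_of_pos h4 _) h1
    rw [Real.log_rpow h4] at h5
    have h6 := (le_max_right 0 (2 - a)).trans_lt ht1
    rw [div_lt_iff_of_neg hlog]
    nlinarith
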